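/- arXiv:2406.16399 — 2 statements merged into one kernel-verified Lean document; each statement's English description precedes it below -/
import Mathlib

section
/- If ρ is a permutation not of any of the following forms — the empty permutation, 1, 12, nα with α ∈ S_{n-1} nonempty, or (n-1)αn with α ∈ S_{n-2} nonempty — then PSB^{-1}(Av(ρ)) is not closed under pattern containment (i.e., it is not a permutation class). -/
/-- `π` is a permutation of `{1,…,n}`, encoded as the list of its values. -/
def IsPermList (n : ℕ) (π : List ℕ) : Prop := π.Perm (List.range' 1 n)

/-- The pattern `σ` occurs in `π`: some subsequence of `π` is order-isomorphic to `σ`. -/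
def Contains (π σ : List ℕ) : Prop :=
  ∃ τ : List ℕ, τ.Sublist π ∧ τ.length = σ.length ∧
    ∀ i j : ℕ, i < τ.length → j < τ.length → (τ[i]! < τ[j]! ↔ σ[i]! < σ[j]!)

/-- `π` avoids the pattern `σ`. -/
def Avoids (π σ : List ℕ) : Prop := ¬ Contains π σ

/-- The pop stack with bypass sorting procedure (algorithm PSB); the second
argument is the pop stack, stored top-first.  Push if the stack is empty or the
current element is `TOP - 1`; bypass if it is `< TOP - 1`; otherwise pop the
whole stack and push.  At the end the stack is popped. -/
def psbAux : List ℕ → List ℕ → List ℕ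
  | [], s => s
  | x :: xs, [] => psbAux xs [x]
  | x :: xs, t :: s =>
      if x + 1 = t then psbAux xs (x :: t :: s)
      else if x + 1 < t then x :: psbAux xs (t :: s)
      else (t :: s) ++ psbAux xs [x]

/-- The map associated with the PSB algorithm. -/
def psb (π : List ℕ) : List ℕ := psbAux π []

/-- A permutation class: a set of permutations closed under pattern containment. -/
def IsPermClass (S : Set (List ℕ)) : Prop :=
  ∀ π ∈ S, ∀ σ : List ℕ, (∃ m, IsPermList m σ) → Contains π σ → σ ∈ S

theorem IsPermList.length_eq {n : ℕ} {l : List ℕ} (h : IsPermList n l) : l.length = n := by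
  simpa using List.Perm.length_eq h

theorem IsPermList.nodup {n : ℕ} {l : List ℕ} (h : IsPermList n l) : l.Nodup :=
  (List.Perm.nodup_iff h).2 List.nodup_range'

theorem IsPermList.mem_iff {n : ℕ} {l : List ℕ} (h : IsPermList n l) {x : ℕ} :
    x ∈ l ↔ 1 ≤ x ∧ x ≤ n := by
  rw [List.Perm.mem_iff h, List.mem_range'_1]
  omega

theorem isPermList_concat_iff {n : ℕ} {l : List ℕ} :
    IsPermList (n + 1) (l ++ [n + 1]) ↔ IsPermList n l := by
  unfold IsPermList
  rw [List.range'_1_concat, Nat.add_comm 1 n, List.perm_append_right_iff]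

/-- The entries around the maximum of a permutation are smaller than it. -/
theorem IsPermList.lt_of_mem {n : ℕ} {α β : List ℕ} (h : IsPermList n (α ++ n :: β)) {x : ℕ}
    (hx : x ∈ α ∨ x ∈ β) : x < n := by
  have hle : x ≤ n := (h.mem_iff.1 (by simp; tauto)).2
  have hnd := h.nodup
  rw [List.nodup_middle, List.nodup_cons, List.mem_append] at hnd
  refine lt_of_le_of_ne hle ?_
  rintro rfl
  exact hnd.1 hx

theorem contains_of_map_sublist {f : ℕ → ℕ} (hf : StrictMono f) {π σ : List ℕ}
    (h : (σ.map f).Sublist π) : Contains π σ := by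
  refine ⟨σ.map f, h, by simp, fun i j hi hj => ?_⟩
  rw [List.length_map] at hi hj
  simp [hi, hj, hf.lt_iff_lt]

theorem contains_of_sublist {π σ : List ℕ} (h : σ.Sublist π) : Contains π σ :=
  contains_of_map_sublist strictMono_id (by simpa using h)

theorem Contains.of_append {π σ σ' : List ℕ} (h : Contains π (σ ++ σ')) : Contains π σ := by
  obtain ⟨τ, hτ, hlen, hord⟩ := h
  rw [List.length_append] at hlen
  refine ⟨τ.take σ.length, (List.take_sublist _ _).trans hτ, by simp; omega, fun i j hi hj => ?_⟩
  rw [List.length_take] at hi hj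
  have hi' : i < σ.length := by omega
  have hj' : j < σ.length := by omega
  have := hord i j (by omega) (by omega)
  grind

/-- The order embedding of `ℕ` into itself whose range misses exactly `m`. -/
def skip (m x : ℕ) : ℕ := if x < m then x else x + 1

theorem strictMono_skip (m : ℕ) : StrictMono (skip m) := by
  intro x y h
  unfold skip
  split_ifs <;> omega

theorem map_skip_eq_self {m : ℕ} {l : List ℕ} (h : ∀ x ∈ l, x < m) : l.map (skip m) = l := by
  conv_rhs => rw [← List.map_id l]
  exact List.map_congr_left fun x hx => if_pos (h x hx)

theorem psbAux_append_of_bypass {xs ys s : List ℕ} {t : ℕ} (h : ∀ x ∈ xs, x + 1 < t) :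
    psbAux (xs ++ ys) (t :: s) = xs ++ psbAux ys (t :: s) := by
  induction xs with
  | nil => rfl
  | cons x xs ih =>
    have hx : x + 1 < t := h x (by simp)
    simp [psbAux, hx, hx.ne, ih fun y hy => h y (by simp [hy])]

theorem psbAux_of_bypass {xs s : List ℕ} {t : ℕ} (h : ∀ x ∈ xs, x + 1 < t) :
    psbAux xs (t :: s) = xs ++ t :: s := by
  simpa [psbAux] using psbAux_append_of_bypass (ys := []) (s := s) h

theorem getElem!_mem_of_lt {l : List ℕ} {i : ℕ} (h : i < l.length) : l[i]! ∈ l := by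
  rw [getElem!_pos l i h]
  exact List.getElem_mem h

theorem dropLast_sublist_of_sublist_concat {τ L : List ℕ} {a : ℕ} (h : τ.Sublist (L ++ [a])) :
    τ.dropLast.Sublist L := by
  obtain ⟨τ₁, τ₂, rfl, h₁, h₂⟩ := List.sublist_append_iff.1 h
  rcases List.sublist_singleton.1 h₂ with rfl | rfl
  · simpa using (List.dropLast_sublist _).trans h₁
  · simpa using h₁

theorem sublist_of_sublist_concat {τ L : List ℕ} {a i : ℕ} (h : τ.Sublist (L ++ [a]))
    (hL : ∀ x ∈ L, x ≤ a) (hi : i < τ.length) (hlt : τ[τ.length - 1]! < τ[i]!) :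
    τ.Sublist L := by
  obtain ⟨τ₁, τ₂, rfl, h₁, h₂⟩ := List.sublist_append_iff.1 h
  rcases List.sublist_singleton.1 h₂ with rfl | rfl
  · simpa using h₁
  · exfalso
    have hmem : (τ₁ ++ [a])[i]! ∈ L ++ [a] := h.subset (getElem!_mem_of_lt hi)
    have hle : (τ₁ ++ [a])[i]! ≤ a := by
      rcases List.mem_append.1 hmem with hm | hm
      · exact hL _ hm
      · exact (List.mem_singleton.1 hm).le
    have hlast : (τ₁ ++ [a])[(τ₁ ++ [a]).length - 1]! = a := by simp
    omega

theorem sublist_of_sublist_cons {τ L : List ℕ} {a i : ℕ} (h : τ.Sublist (a :: L))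
    (hi : i < τ.length) (hle : τ[i]! ≤ a) (hlt : τ[0]! < τ[i]!) : τ.Sublist L := by
  rcases List.sublist_cons_iff.1 h with h | ⟨r, rfl, -⟩
  · exact h
  · simp at hlt hle
    omega

theorem not_isPermClass_of_max_interior {m : ℕ} {α β ρ : List ℕ} (hα : α ≠ []) (hβ : β ≠ [])
    (hp : IsPermList m (α ++ m :: β))
    (hρ : ρ = α ++ m :: β ∨ ρ = α ++ m :: β ++ [m + 1]) :
    ¬ IsPermClass {π : List ℕ | (∃ k, IsPermList k π) ∧ Avoids (psb π) ρ} := by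
  have hαlt : ∀ x ∈ α, x < m := fun x hx => hp.lt_of_mem (Or.inl hx)
  have hβlt : ∀ x ∈ β, x < m := fun x hx => hp.lt_of_mem (Or.inr hx)
  set σ := (m + 1) :: (α ++ (m + 2) :: (β ++ [m])) with hσ
  have hσ_perm : IsPermList (m + 2) σ := by
    refine List.Perm.trans ?_ (isPermList_concat_iff.2 (isPermList_concat_iff.2 hp))
    rw [List.perm_iff_count]
    intro a
    simp [hσ, List.count_cons, List.count_append, Nat.add_assoc]
    omega
  have hπ_perm : IsPermList (m + 3) ((m + 3) :: σ) :=
    (List.perm_append_singleton _ _).symm.trans (isPermList_concat_iff.2 hσ_perm)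
  have hpsb_σ : psb σ = α ++ (m + 1) :: (β ++ [m, m + 2]) := by
    simp only [hσ, psb, psbAux]
    rw [psbAux_append_of_bypass fun x hx => by have := hαlt x hx; omega]
    simp only [psbAux]
    rw [if_neg (by omega), if_neg (by omega), psbAux_of_bypass]
    · simp
    · simp only [List.mem_append, List.mem_singleton]
      rintro x (hx | rfl)
      · have := hβlt x hx; omega
      · omega
  have hpsb_π : psb ((m + 3) :: σ) = (m + 1) :: (α ++ β ++ [m] ++ [m + 2] ++ [m + 3]) := by
    simp only [hσ, psb, psbAux]
    rw [if_neg (by omega), if_pos (by omega),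
      psbAux_append_of_bypass (t := m + 3) fun x hx => by have := hαlt x hx; omega]
    simp only [psbAux]
    rw [if_pos trivial, psbAux_of_bypass]
    · simp
    · simp only [List.mem_append, List.mem_singleton]
      rintro x (hx | rfl)
      · have := hβlt x hx; omega
      · omega
  have hcontains : Contains (psb σ) (α ++ m :: β ++ [m + 1]) := by
    refine contains_of_map_sublist (strictMono_skip m) ?_
    simp only [List.map_append, List.map_cons, List.map_nil, map_skip_eq_self hαlt,
      map_skip_eq_self hβlt, hpsb_σ]
    simp [skip]
  have havoids : Avoids (psb ((m + 3) :: σ)) (α ++ m :: β) := by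
    rintro ⟨τ, hτ, hlen, hord⟩
    have hα0 := List.length_pos_iff.2 hα
    have hβ0 := List.length_pos_iff.2 hβ
    have hlen' : τ.length = α.length + β.length + 1 := by simp [hlen]; omega
    have hmax : (α ++ m :: β)[α.length]! = m := by simp
    have hfirst : τ[0]! < τ[α.length]! := by
      rw [hord _ _ (by omega) (by omega), hmax]
      refine hαlt _ ?_
      simp [hα0]
    have hlast : τ[τ.length - 1]! < τ[α.length]! := by
      rw [hord _ _ (by omega) (by omega), hmax]
      refine hβlt _ ?_
      rw [getElem!_pos _ _ (by omega), List.getElem_append_right (by omega),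
        List.getElem_cons, dif_neg (by omega)]
      exact List.getElem_mem _
    have hi : α.length < τ.length := by omega
    rw [hpsb_π, ← List.cons_append, ← List.cons_append] at hτ
    have hbound : ∀ x ∈ (m + 1) :: (α ++ β ++ [m]), x ≤ m + 1 := by
      simp only [List.mem_cons, List.mem_append, List.not_mem_nil, or_false]
      rintro x (rfl | (hx | hx) | rfl)
      · omega
      · have := hαlt x hx; omega
      · have := hβlt x hx; omega
      · omega
    replace hτ := sublist_of_sublist_concat hτ (fun x hx => by
      rcases List.mem_append.1 hx with hx | hx
      · have := hbound x hx; omega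
      · have := List.mem_singleton.1 hx; omega) hi hlast
    replace hτ := sublist_of_sublist_concat hτ (fun x hx => (hbound x hx).trans (by omega)) hi hlast
    replace hτ := sublist_of_sublist_cons hτ hi
      (hbound _ (hτ.subset (getElem!_mem_of_lt hi))) hfirst
    replace hτ := sublist_of_sublist_concat hτ (fun x hx => by
      rcases List.mem_append.1 hx with hx | hx
      · exact (hαlt x hx).le
      · exact (hβlt x hx).le) hi hlast
    have := hτ.length_le
    simp only [List.length_append] at this
    omega
  intro hclass
  have hmem := hclass ((m + 3) :: σ) ⟨⟨_, hπ_perm⟩, fun h => havoids (by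
    rcases hρ with rfl | rfl
    · exact h
    · exact h.of_append)⟩ σ ⟨_, hσ_perm⟩ (contains_of_sublist (List.sublist_cons_self _ _))
  refine hmem.2 ?_
  rcases hρ with rfl | rfl
  · exact hcontains.of_append
  · exact hcontains

theorem not_isPermClass_of_top_two_last {k : ℕ} {γ : List ℕ} (hγ : 2 ≤ γ.length)
    (hp : IsPermList (k + 1) (γ ++ [k] ++ [k + 1])) :
    ¬ IsPermClass {π : List ℕ | (∃ m, IsPermList m π) ∧
      Avoids (psb π) (γ ++ [k] ++ [k + 1])} := by
  have hpk : IsPermList k (γ ++ [k]) := isPermList_concat_iff.1 hp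
  have hγlt : ∀ x ∈ γ, x < k := fun x hx => hpk.lt_of_mem (Or.inl hx)
  have hlenk : γ.length + 1 = k := by simpa using hpk.length_eq
  set σ := (k + 2) :: k :: (k + 1) :: γ with hσ
  set π := (k + 2) :: (k + 3) :: k :: (k + 1) :: γ with hπ
  have hσ_perm : IsPermList (k + 2) σ := by
    refine List.Perm.trans ?_ (isPermList_concat_iff.2 hp)
    rw [List.perm_iff_count]
    intro a
    simp [hσ, List.count_cons, List.count_append, Nat.add_assoc]
    omega
  have hπ_perm : IsPermList (k + 3) π := by
    refine List.Perm.trans ?_ (isPermList_concat_iff.2 hσ_perm)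
    rw [List.perm_iff_count]
    intro a
    simp [hσ, hπ, List.count_cons, List.count_append, Nat.add_assoc]
    omega
  have hpsb_σ : psb σ = k :: (γ ++ [k + 1, k + 2]) := by
    simp only [hσ, psb, psbAux]
    rw [if_neg (by omega), if_pos (by omega), if_pos trivial,
      psbAux_of_bypass fun x hx => by have := hγlt x hx; omega]
  have hpsb_π : psb π = (k + 2) :: k :: (k + 1) :: γ ++ [k + 3] := by
    simp only [hπ, psb, psbAux]
    rw [if_neg (by omega), if_neg (by omega), if_neg (show ¬ k + 1 = k + 3 by omega),
      if_pos (show k + 1 < k + 3 by omega), if_neg (by omega), if_pos (by omega),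
      psbAux_of_bypass fun x hx => by have := hγlt x hx; omega]
    simp
  have hcontains : Contains (psb σ) (γ ++ [k] ++ [k + 1]) := by
    refine contains_of_map_sublist (strictMono_skip k) ?_
    simp only [List.map_append, List.map_cons, List.map_nil, map_skip_eq_self hγlt, hpsb_σ]
    simp [skip]
  have hσπ : Contains π σ := by
    refine contains_of_map_sublist (strictMono_skip (k + 2)) ?_
    have : γ.map (skip (k + 2)) = γ :=
      map_skip_eq_self fun x hx => by have := hγlt x hx; omega
    simp [hσ, hπ, this, skip]
  have havoids : Avoids (psb π) (γ ++ [k] ++ [k + 1]) := by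
    rintro ⟨τ, hτ, hlen, hord⟩
    have hlen' : τ.length = γ.length + 2 := by simpa using hlen
    have hfirst : τ[0]! < τ[γ.length]! := by
      rw [hord _ _ (by omega) (by omega)]
      have : (γ ++ [k] ++ [k + 1])[γ.length]! = k := by simp
      rw [this]
      refine hγlt _ ?_
      have : 0 < γ.length := by omega
      simp [this]
    rw [hpsb_π] at hτ
    replace hτ := dropLast_sublist_of_sublist_concat hτ
    set τ' := τ.dropLast with hτ'
    have hlenτ' : τ'.length = γ.length + 1 := by simp [hτ', hlen']
    have hi : γ.length < τ'.length := by omega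
    replace hfirst : τ'[0]! < τ'[γ.length]! := by
      have h0 : 0 < τ'.length := by omega
      rw [getElem!_pos τ' _ h0, getElem!_pos τ' _ hi]
      simp only [hτ', List.getElem_dropLast]
      rwa [getElem!_pos τ _ (by omega), getElem!_pos τ _ (by omega)] at hfirst
    have hmem : τ'[γ.length]! ∈ τ' := getElem!_mem_of_lt hi
    replace hτ := sublist_of_sublist_cons hτ hi (by
      have := hτ.subset hmem
      simp only [List.mem_cons] at this
      rcases this with h | h | h | h
      · omega
      · omega
      · omega
      · have := hγlt _ h; omega) hfirst
    have hlt : τ'[γ.length]! < k := by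
      refine hγlt _ ((hτ.drop 2).subset ?_)
      rw [List.mem_iff_getElem]
      refine ⟨γ.length - 2, by simp; omega, ?_⟩
      rw [getElem!_pos τ' _ hi]
      simp only [List.getElem_drop]
      congr 1
      omega
    replace hτ := sublist_of_sublist_cons hτ hi (by omega) hfirst
    replace hτ := sublist_of_sublist_cons hτ hi (by omega) hfirst
    have := hτ.length_le
    omega
  intro hclass
  exact (hclass π ⟨⟨_, hπ_perm⟩, havoids⟩ σ ⟨_, hσ_perm⟩ hσπ).2 hcontains

theorem not_isPermClass_one_two_three :
    ¬ IsPermClass {π : List ℕ | (∃ m, IsPermList m π) ∧ Avoids (psb π) [1, 2, 3]} := by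
  intro hclass
  refine (hclass [3, 4, 2, 1] ⟨⟨4, by unfold IsPermList; decide⟩, ?_⟩ [3, 2, 1]
    ⟨3, by unfold IsPermList; decide⟩ ?_).2 ?_
  · have hpsb : psb [3, 4, 2, 1] = [3, 2, 1, 4] := by decide
    rintro ⟨τ, hτ, hlen, hord⟩
    simp only [List.length_cons, List.length_nil] at hlen
    have h01 := hord 0 1 (by omega) (by omega)
    have h12 := hord 1 2 (by omega) (by omega)
    rw [hpsb, ← List.mem_sublists] at hτ
    revert h12 h01 hlen
    clear hord
    revert τ
    decide
  · exact contains_of_map_sublist (strictMono_skip 3) (by decide)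
  · exact contains_of_sublist (by decide)

theorem psb_preimage_not_class (ρ : List ℕ) (hρ : IsPermList ρ.length ρ)
    (h1 : ρ ≠ []) (h2 : ρ ≠ [1]) (h3 : ρ ≠ [1, 2])
    (h4 : ∀ α : List ℕ, α ≠ [] → ρ ≠ ρ.length :: α)
    (h5 : ∀ α : List ℕ, α ≠ [] → ρ ≠ (ρ.length - 1) :: (α ++ [ρ.length])) :
    ¬ IsPermClass {π : List ℕ | (∃ m, IsPermList m π) ∧ Avoids (psb π) ρ} := by
  have hpos := List.length_pos_iff.2 h1
  obtain ⟨k, hk⟩ : ∃ k, ρ.length = k + 1 := ⟨ρ.length - 1, by omega⟩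
  rw [hk] at hρ h4 h5
  obtain ⟨α, β, hαβ⟩ := List.append_of_mem (hρ.mem_iff.2 ⟨by omega, le_refl (k + 1)⟩)
  rcases eq_or_ne α [] with rfl | hα
  · rcases eq_or_ne β [] with rfl | hβ
    · obtain rfl : k = 0 := by simpa [hαβ] using hk.symm
      exact absurd hαβ h2
    · exact absurd hαβ (h4 β hβ)
  rcases eq_or_ne β [] with rfl | hβ
  swap
  · exact not_isPermClass_of_max_interior hα hβ (hαβ ▸ hρ) (Or.inl hαβ)
  have hpα : IsPermList k α := isPermList_concat_iff.1 (hαβ ▸ hρ)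
  have hk0 : 0 < k := hpα.length_eq ▸ List.length_pos_iff.2 hα
  obtain ⟨γ, δ, rfl⟩ := List.append_of_mem (hpα.mem_iff.2 ⟨hk0, le_refl k⟩)
  rcases eq_or_ne γ [] with rfl | hγ
  · rcases eq_or_ne δ [] with rfl | hδ
    · obtain rfl : k = 1 := by simpa using hpα.length_eq.symm
      exact absurd hαβ h3
    · exact absurd hαβ (by simpa using h5 δ hδ)
  rcases eq_or_ne δ [] with rfl | hδ
  swap
  · exact not_isPermClass_of_max_interior hγ hδ hpα (Or.inr hαβ)
  rcases Nat.lt_or_ge γ.length 2 with hlt | hge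
  · have hγ1 : γ.length = 1 := by have := List.length_pos_iff.2 hγ; omega
    obtain ⟨x, rfl⟩ := List.length_eq_one_iff.1 hγ1
    obtain rfl : k = 2 := by simpa using hpα.length_eq.symm
    have hx1 := (hpα.mem_iff (x := x)).1 (by simp)
    have hx2 := hpα.lt_of_mem (x := x) (by simp)
    obtain rfl : x = 1 := by omega
    rw [hαβ]
    exact not_isPermClass_one_two_three
  · subst hαβ
    exact not_isPermClass_of_top_two_last hge hρ
end

section
/- For a permutation π of size n, PSB(Queuesort(π)) = id_n if and only if π avoids all three patterns 4231, 2431, and 54213. -/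
/-- The (optimal) Queuesort procedure, using a queue with a bypass; the second
argument is the queue, front-first. -/
def queuesortAux : List ℕ → List ℕ → List ℕ
  | [], q => q
  | x :: xs, q =>
      match q.getLast? with
      | none => queuesortAux xs [x]
      | some b =>
          if b < x then queuesortAux xs (q ++ [x])
          else q.takeWhile (fun a => decide (a < x)) ++
            x :: queuesortAux xs (q.dropWhile (fun a => decide (a < x)))

/-- The map associated with Queuesort. -/
def queuesort (π : List ℕ) : List ℕ := queuesortAux π []

/-- One pass of Bubblesort: traverse left to right, swapping adjacent
out-of-order entries. -/
def bubblesort : List ℕ → List ℕ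
  | [] => []
  | [x] => [x]
  | x :: y :: xs => if x ≤ y then x :: bubblesort (y :: xs) else y :: bubblesort (x :: xs)

/-! ### Occurrences of short subsequences -/

theorem pair_sublist_append_iff {x y : ℕ} {l₁ l₂ : List ℕ} :
    [x, y].Sublist (l₁ ++ l₂) ↔
      [x, y].Sublist l₁ ∨ (x ∈ l₁ ∧ y ∈ l₂) ∨ [x, y].Sublist l₂ := by
  induction l₁ with
  | nil => simp
  | cons z l ih =>
    simp only [List.cons_append, List.cons_sublist_cons', ih, List.singleton_sublist,
      List.mem_append, List.mem_cons]
    tauto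

theorem pair_sublist_cons_iff {x y z : ℕ} {l : List ℕ} :
    [x, y].Sublist (z :: l) ↔ (x = z ∧ y ∈ l) ∨ [x, y].Sublist l := by
  simp only [List.cons_sublist_cons', List.singleton_sublist]
  tauto

theorem rel_of_pair_sublist {R : ℕ → ℕ → Prop} {l : List ℕ} (h : l.Pairwise R) {x y : ℕ}
    (hs : [x, y].Sublist l) : R x y := by
  simpa using h.sublist hs

theorem sublist_iff_idxOf {τ l : List ℕ} (hl : l.Nodup) :
    τ.Sublist l ↔ (∀ x ∈ τ, x ∈ l) ∧ τ.Pairwise (fun x y => l.idxOf x < l.idxOf y) := by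
  have hp : l.Pairwise (fun x y => l.idxOf x < l.idxOf y) := by
    rw [List.pairwise_iff_getElem]
    intro i j hi hj hij
    rwa [hl.idxOf_getElem, hl.idxOf_getElem]
  refine ⟨fun h => ⟨fun x hx => h.subset hx, hp.sublist h⟩, fun ⟨hm, hτ⟩ => ?_⟩
  have hf : (l.filter (· ∈ τ)).Sublist l := List.filter_sublist
  have hnd : τ.Nodup := hτ.imp (fun h e => by subst e; exact lt_irrefl _ h)
  have hperm : τ.Perm (l.filter (· ∈ τ)) := by
    rw [List.perm_ext_iff_of_nodup hnd (hl.filter _)]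
    intro a
    simp only [List.mem_filter, decide_eq_true_eq]
    exact ⟨fun h => ⟨hm a h, h⟩, fun h => h.2⟩
  have heq : τ = l.filter (· ∈ τ) :=
    List.Perm.eq_of_pairwise (fun a b _ _ h₁ h₂ => absurd h₁ (lt_asymm h₂)) hτ
      (hp.sublist hf) hperm
  rw [heq]
  exact hf

/-- An increasing triple of values `a < b < c` occurring in the order `b, c, a`. -/
def Has231 (l : List ℕ) : Prop :=
  ∃ a b c, a < b ∧ b < c ∧ [b, c, a].Sublist l

/-- Values `a < b < c < d` occurring in the order `d, b, a, c`. -/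
def Has4213 (l : List ℕ) : Prop :=
  ∃ a b c d, a < b ∧ b < c ∧ c < d ∧ [d, b, a, c].Sublist l

theorem contains_4231_iff {l : List ℕ} :
    Contains l [4, 2, 3, 1] ↔
      ∃ a b c d, a < b ∧ b < c ∧ c < d ∧ [d, b, c, a].Sublist l := by
  constructor
  · rintro ⟨τ, hs, hlen, h⟩
    match τ, hlen with
    | [d, b, c, a], _ =>
      have h₁ := h 3 1 (by simp) (by simp)
      have h₂ := h 1 2 (by simp) (by simp)
      have h₃ := h 2 0 (by simp) (by simp)
      simp at h₁ h₂ h₃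
      exact ⟨a, b, c, d, h₁, h₂, h₃, hs⟩
  · rintro ⟨a, b, c, d, hab, hbc, hcd, hs⟩
    refine ⟨_, hs, rfl, fun i j hi hj => ?_⟩
    simp only [List.length_cons, List.length_nil] at hi hj
    interval_cases i <;> interval_cases j <;> simp <;> omega

theorem contains_2431_iff {l : List ℕ} :
    Contains l [2, 4, 3, 1] ↔
      ∃ a b c d, a < b ∧ b < c ∧ c < d ∧ [b, d, c, a].Sublist l := by
  constructor
  · rintro ⟨τ, hs, hlen, h⟩
    match τ, hlen with
    | [b, d, c, a], _ =>
      have h₁ := h 3 0 (by simp) (by simp)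
      have h₂ := h 0 2 (by simp) (by simp)
      have h₃ := h 2 1 (by simp) (by simp)
      simp at h₁ h₂ h₃
      exact ⟨a, b, c, d, h₁, h₂, h₃, hs⟩
  · rintro ⟨a, b, c, d, hab, hbc, hcd, hs⟩
    refine ⟨_, hs, rfl, fun i j hi hj => ?_⟩
    simp only [List.length_cons, List.length_nil] at hi hj
    interval_cases i <;> interval_cases j <;> simp <;> omega

theorem contains_54213_iff {l : List ℕ} :
    Contains l [5, 4, 2, 1, 3] ↔
      ∃ a b c d e, a < b ∧ b < c ∧ c < d ∧ d < e ∧ [e, d, b, a, c].Sublist l := by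
  constructor
  · rintro ⟨τ, hs, hlen, h⟩
    match τ, hlen with
    | [e, d, b, a, c], _ =>
      have h₁ := h 3 2 (by simp) (by simp)
      have h₂ := h 2 4 (by simp) (by simp)
      have h₃ := h 4 1 (by simp) (by simp)
      have h₄ := h 1 0 (by simp) (by simp)
      simp at h₁ h₂ h₃ h₄
      exact ⟨a, b, c, d, e, h₁, h₂, h₃, h₄, hs⟩
  · rintro ⟨a, b, c, d, e, hab, hbc, hcd, hde, hs⟩
    refine ⟨_, hs, rfl, fun i j hi hj => ?_⟩
    simp only [List.length_cons, List.length_nil] at hi hj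
    interval_cases i <;> interval_cases j <;> simp <;> omega

/-! ### Queuesort -/

/-- `QueueRun xs q out`: Queuesort with increasing queue `q` and remaining input `xs`
produces `out`. -/
inductive QueueRun : List ℕ → List ℕ → List ℕ → Prop
  | done {q : List ℕ} (hq : q.Pairwise (· < ·)) : QueueRun [] q q
  | push {x : ℕ} {xs q out : List ℕ} (hq : q.Pairwise (· < ·)) (hx : ∀ y ∈ q, y < x)
      (h : QueueRun xs (q ++ [x]) out) : QueueRun (x :: xs) q out
  | bypass {x m : ℕ} {xs q₁ q₂ out : List ℕ} (hq : (q₁ ++ q₂).Pairwise (· < ·))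
      (h₁ : ∀ y ∈ q₁, y < x) (h₂ : ∀ y ∈ q₂, x < y) (hm : m ∈ q₂) (hmax : ∀ y ∈ q₂, y ≤ m)
      (h : QueueRun xs q₂ out) : QueueRun (x :: xs) (q₁ ++ q₂) (q₁ ++ x :: out)

theorem queueRun_queuesortAux (xs q : List ℕ) (hq : q.Pairwise (· < ·)) (hn : (q ++ xs).Nodup) :
    QueueRun xs q (queuesortAux xs q) := by
  induction xs generalizing q with
  | nil => simpa [queuesortAux] using QueueRun.done hq
  | cons x xs ih =>
    rcases List.eq_nil_or_concat q with rfl | ⟨p, b, rfl⟩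
    · refine QueueRun.push (by simp) (by simp) ?_
      simpa [queuesortAux] using ih [x] (by simp) (by simpa using hn)
    · simp only [List.concat_eq_append] at *
      have hpb : ∀ y ∈ p, y < b := by
        intro y hy
        exact (List.pairwise_append.1 hq).2.2 y hy b (by simp)
      have hxb : x ≠ b := by
        rintro rfl
        simp [List.nodup_append] at hn
      by_cases hbx : b < x
      · have hall : ∀ y ∈ p ++ [b], y < x := by
          intro y hy
          simp only [List.mem_append, List.mem_singleton] at hy
          rcases hy with hy | rfl
          · exact (hpb y hy).trans hbx
          · exact hbx
        have e : queuesortAux (x :: xs) (p ++ [b]) = queuesortAux xs (p ++ [b] ++ [x]) := by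
          simp [queuesortAux, hbx]
        rw [e]
        refine QueueRun.push hq hall (ih _ ?_ (by simpa using hn))
        rw [List.pairwise_append]
        exact ⟨hq, by simp, by simpa using hall⟩
      · have hxb' : x < b := by omega
        generalize hQ : p ++ [b] = Q at *
        have hbQ : b ∈ Q := by simp [← hQ]
        have hle : ∀ y ∈ Q, y ≤ b := by
          intro y hy
          rw [← hQ] at hy
          simp only [List.mem_append, List.mem_singleton] at hy
          rcases hy with hy | rfl
          · exact (hpb y hy).le
          · exact le_rfl
        have hlast : Q.getLast? = some b := by simp [← hQ]
        have e : queuesortAux (x :: xs) Q = Q.takeWhile (fun a => decide (a < x)) ++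
            x :: queuesortAux xs (Q.dropWhile (fun a => decide (a < x))) := by
          simp [queuesortAux, hlast, hbx]
        rw [e]
        have hsplit := List.takeWhile_append_dropWhile (p := fun a => decide (a < x)) (l := Q)
        have h₁ : ∀ y ∈ Q.takeWhile (fun a => decide (a < x)), y < x := by
          intro y hy
          simpa using List.mem_takeWhile_imp hy
        have hdrop : (Q.dropWhile (fun a => decide (a < x))).Sublist Q := List.dropWhile_sublist _
        have h₂ : ∀ y ∈ Q.dropWhile (fun a => decide (a < x)), x < y := by
          intro y hy
          have hne : y ≠ x := by
            rintro rfl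
            have := hdrop.subset hy
            rw [List.nodup_append] at hn
            exact hn.2.2 y this y (by simp) rfl
          have hle : x ≤ y := by
            have hsd := hq.sublist hdrop
            have hh := List.head?_dropWhile_not (fun a => decide (a < x)) Q
            cases hd : Q.dropWhile (fun a => decide (a < x)) with
            | nil => simp [hd] at hy
            | cons z l =>
              rw [hd] at hy hsd hh
              simp at hh
              rcases List.mem_cons.1 hy with rfl | hy
              · exact hh
              · exact hh.trans ((List.pairwise_cons.1 hsd).1 y hy).le
          omega
        have hm : b ∈ Q.dropWhile (fun a => decide (a < x)) := by
          have : b ∈ Q.takeWhile (fun a => decide (a < x)) ++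
              Q.dropWhile (fun a => decide (a < x)) := by rwa [hsplit]
          rcases List.mem_append.1 this with h | h
          · exact absurd (h₁ b h) hbx
          · exact h
        have key := QueueRun.bypass (xs := xs) (x := x) (by rwa [hsplit]) h₁ h₂ hm
          (fun y hy => hle y (hdrop.subset hy))
          (ih _ (hq.sublist hdrop) (hn.sublist (hdrop.append (List.sublist_cons_self x xs))))
        rwa [hsplit] at key

namespace QueueRun

variable {xs q out : List ℕ}

theorem perm (h : QueueRun xs q out) : out.Perm (q ++ xs) := by
  induction h with
  | done => simp
  | push hq hx h ih => simpa using ih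
  | @bypass x m xs q₁ q₂ out hq h₁ h₂ hm hmax h ih =>
    rw [List.append_assoc]
    refine List.Perm.append_left _ ?_
    exact (ih.cons x).trans List.perm_middle.symm

theorem mem_iff (h : QueueRun xs q out) {y : ℕ} : y ∈ out ↔ y ∈ q ∨ y ∈ xs := by
  rw [h.perm.mem_iff, List.mem_append]

/-- Increasing pairs of the queue leave in order. -/
theorem pair_of_queue {a b : ℕ} (h : QueueRun xs q out) (hs : [a, b].Sublist q) :
    [a, b].Sublist out := by
  induction h with
  | done => exact hs
  | push hq hx h ih => exact ih (hs.trans (List.sublist_append_left _ _))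
  | bypass hq h₁ h₂ hm hmax h ih =>
    have := h.mem_iff (y := b)
    simp only [pair_sublist_append_iff, pair_sublist_cons_iff, List.mem_cons] at hs ⊢
    tauto

theorem pair_of_queue_input {a b : ℕ} (h : QueueRun xs q out) (hab : a < b) (ha : a ∈ q)
    (hb : b ∈ xs) : [a, b].Sublist out := by
  induction h with
  | done => simp at hb
  | push hq hx h ih =>
    rcases List.mem_cons.1 hb with rfl | hb
    · exact h.pair_of_queue (pair_sublist_append_iff.2 (by simp [ha]))
    · exact ih (by simp [ha]) hb
  | bypass hq h₁ h₂ hm hmax h ih =>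
    have := h.mem_iff (y := b)
    simp only [pair_sublist_append_iff, pair_sublist_cons_iff, List.mem_cons,
      List.mem_append] at *
    grind

/-- Queuesort creates no new inversion. -/
theorem pair_of_input {a b : ℕ} (h : QueueRun xs q out) (hab : a < b) (hs : [a, b].Sublist xs) :
    [a, b].Sublist out := by
  induction h with
  | done => simp at hs
  | push hq hx h ih =>
    rcases pair_sublist_cons_iff.1 hs with ⟨rfl, hb⟩ | hs
    · exact h.pair_of_queue_input hab (by simp) hb
    · exact ih hs
  | bypass hq h₁ h₂ hm hmax h ih =>
    have := h.mem_iff (y := b)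
    simp only [pair_sublist_append_iff, pair_sublist_cons_iff, List.mem_cons] at *
    tauto

theorem inv_of_queue_max {a b d : ℕ} (h : QueueRun xs q out) (hbd : b < d)
    (hd : d ∈ q) (hs : [b, a].Sublist xs) : [b, a].Sublist out := by
  induction h generalizing d with
  | done => simp at hs
  | push hq hx h ih =>
    rcases pair_sublist_cons_iff.1 hs with ⟨rfl, hb⟩ | hs
    · exact absurd (hx d hd) (lt_asymm hbd)
    · exact ih hbd (by simp [hd]) hs
  | @bypass x m xs q₁ q₂ out hq h₁ h₂ hm hmax h ih =>
    have := h.mem_iff (y := a)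
    have ih' := @ih m
    simp only [pair_sublist_append_iff, pair_sublist_cons_iff, List.mem_cons,
      List.mem_append] at *
    grind

/-- An inversion survives if its larger entry is not a left-to-right maximum. -/
theorem inv_of_three {a b d : ℕ} (h : QueueRun xs q out) (hbd : b < d)
    (hs : [d, b, a].Sublist xs) : [b, a].Sublist out := by
  induction h with
  | done => simp at hs
  | push hq hx h ih =>
    rcases List.cons_sublist_cons'.1 hs with hs | ⟨rfl, hs'⟩
    · exact ih hs
    · exact h.inv_of_queue_max hbd (by simp) hs'
  | @bypass x m xs q₁ q₂ out hq h₁ h₂ hm hmax h ih =>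
    have : [b, a].Sublist out := by
      rcases List.cons_sublist_cons'.1 hs with hs | ⟨rfl, hs'⟩
      · exact ih hs
      · exact h.inv_of_queue_max (hbd.trans (h₂ _ hm)) hm hs'
    exact (this.cons _).trans (List.sublist_append_right _ _)

/-- If Queuesort leaves the inversion `b, a`, then either `b` is not a left-to-right maximum or
`b, a` extends to an occurrence `b, d, c, a` of 2431. -/
theorem of_inv {a b : ℕ} (h : QueueRun xs q out) (hab : a < b) (hs : [b, a].Sublist out) :
    (∃ d, b < d ∧ [d, b, a].Sublist (q ++ xs)) ∨
      ∃ c d, b < c ∧ c < d ∧ [b, d, c, a].Sublist (q ++ xs) := by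
  induction h with
  | done hq => exact absurd (rel_of_pair_sublist hq hs) (lt_asymm hab)
  | push hq hx h ih => simpa using ih hs
  | @bypass x m xs q₁ q₂ out hq h₁ h₂ hm hmax h ih =>
    have hmem : a ∈ out → a < x → a ∈ xs := by
      intro ha hax
      rcases h.mem_iff.1 ha with ha | ha
      · exact absurd (h₂ a ha) (lt_asymm hax)
      · exact ha
    have hq₁ := (List.pairwise_append.1 hq).1
    rcases pair_sublist_append_iff.1 hs with hs | ⟨hb, ha⟩ | hs
    · exact absurd (rel_of_pair_sublist hq₁ hs) (lt_asymm hab)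
    · have hbx := h₁ b hb
      have ha' : a ∈ xs := by
        rcases List.mem_cons.1 ha with rfl | ha
        · omega
        · exact hmem ha (by omega)
      refine Or.inr ⟨x, m, hbx, h₂ m hm, ?_⟩
      have e₁ : [b, m].Sublist (q₁ ++ q₂) := pair_sublist_append_iff.2 (Or.inr (Or.inl ⟨hb, hm⟩))
      have e₂ : [x, a].Sublist (x :: xs) := List.Sublist.cons_cons _ (List.singleton_sublist.2 ha')
      exact e₁.append e₂
    · rcases pair_sublist_cons_iff.1 hs with ⟨rfl, ha⟩ | hs
      · refine Or.inl ⟨m, h₂ m hm, ?_⟩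
        have e₁ : [m].Sublist (q₁ ++ q₂) := List.singleton_sublist.2 (by simp [hm])
        exact e₁.append (List.Sublist.cons_cons _ (List.singleton_sublist.2 (hmem ha hab)))
      · have hsub : (q₂ ++ xs).Sublist (q₁ ++ q₂ ++ x :: xs) :=
          (List.sublist_append_right _ _).append (List.sublist_cons_self _ _)
        rcases ih hs with ⟨d, hd, hs⟩ | ⟨c, d, hc, hd, hs⟩
        · exact Or.inl ⟨d, hd, hs.trans hsub⟩
        · exact Or.inr ⟨c, d, hc, hd, hs.trans hsub⟩

end QueueRun

theorem queueRun_queuesort {l : List ℕ} (hl : l.Nodup) : QueueRun l [] (queuesort l) :=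
  queueRun_queuesortAux l [] List.Pairwise.nil (by simpa using hl)

theorem queuesort_avoids_iff {l : List ℕ} (hl : l.Nodup) :
    ¬ Has231 (queuesort l) ∧ ¬ Has4213 (queuesort l) ↔
      Avoids l [4, 2, 3, 1] ∧ Avoids l [2, 4, 3, 1] ∧ Avoids l [5, 4, 2, 1, 3] := by
  have hrun := queueRun_queuesort hl
  have hperm : (queuesort l).Perm l := by simpa using hrun.perm
  have hmem : ∀ y, y ∈ queuesort l ↔ y ∈ l := fun y => hperm.mem_iff
  have hq : (queuesort l).Nodup := hperm.nodup_iff.2 hl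
  have inc : ∀ {a b : ℕ}, a < b → [a, b].Sublist l → [a, b].Sublist (queuesort l) :=
    fun h => hrun.pair_of_input h
  have dec₁ : ∀ {a b d : ℕ}, b < d → [d, b, a].Sublist l → [b, a].Sublist (queuesort l) :=
    fun h => hrun.inv_of_three h
  have inv : ∀ {a b : ℕ}, a < b → [b, a].Sublist (queuesort l) →
      (∃ d, b < d ∧ [d, b, a].Sublist l) ∨
        ∃ c d, b < c ∧ c < d ∧ [b, d, c, a].Sublist l := fun h h' => by
    simpa using hrun.of_inv h h'
  clear hrun hperm
  simp only [Avoids, contains_4231_iff, contains_2431_iff, contains_54213_iff, Has231, Has4213]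
  simp only [sublist_iff_idxOf hl, sublist_iff_idxOf hq, List.mem_cons, List.not_mem_nil,
    or_false, forall_eq_or_imp, forall_eq, List.pairwise_cons, List.Pairwise.nil, and_true,
    IsEmpty.forall_iff, implies_true, hmem] at *
  have inj : ∀ {a b : ℕ}, a ∈ l → b ∈ l → l.idxOf a = l.idxOf b → a = b := fun ha _ h =>
    (List.idxOf_inj ha).1 h
  obtain ⟨p, hp⟩ : ∃ p : ℕ → ℕ, ∀ x, (queuesort l).idxOf x = p x := ⟨_, fun _ => rfl⟩
  obtain ⟨r, hr⟩ : ∃ r : ℕ → ℕ, ∀ x, l.idxOf x = r x := ⟨_, fun _ => rfl⟩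
  simp only [hp, hr] at inc dec₁ inv inj ⊢
  clear hp hr hmem hl hq
  constructor
  · rintro ⟨h₁, h₂⟩
    refine ⟨?_, ?_, ?_⟩
    · rintro ⟨a, b, c, d, hab, hbc, hcd, hs⟩
      apply h₁
      refine ⟨a, b, c, hab, hbc, ?_⟩
      have e₁ := @inc b c
      have e₂ := @dec₁ a c d
      clear inc dec₁ inv inj h₁ h₂
      grind
    · rintro ⟨a, b, c, d, hab, hbc, hcd, hs⟩
      apply h₁
      refine ⟨a, b, c, hab, hbc, ?_⟩
      have e₁ := @inc b c
      have e₂ := @dec₁ a c d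
      clear inc dec₁ inv inj h₁ h₂
      grind
    · rintro ⟨a, b, c, d, e, hab, hbc, hcd, hde, hs⟩
      apply h₂
      refine ⟨a, b, c, d, hab, hbc, hcd, ?_⟩
      have e₁ := @inc a c
      have e₂ := @dec₁ b d e
      have e₃ := @dec₁ a b d
      clear inc dec₁ inv inj h₁ h₂
      grind
  · rintro ⟨h₁, h₂, h₃⟩
    refine ⟨?_, ?_⟩
    · rintro ⟨a, b, c, hab, hbc, hs⟩
      have hd : ∃ d, b < d ∧ (d ∈ l ∧ b ∈ l ∧ a ∈ l) ∧ (r d < r b ∧ r d < r a) ∧ r b < r a := by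
        rcases inv hab (by tauto) with h | ⟨c', d, h, h', h''⟩
        · exact h
        · exact absurd ⟨a, b, c', d, hab, h, h', h''⟩ h₂
      have he : ∃ d, c < d ∧ (d ∈ l ∧ c ∈ l ∧ a ∈ l) ∧ (r d < r c ∧ r d < r a) ∧ r c < r a := by
        rcases inv (hab.trans hbc) (by tauto) with h | ⟨c', d, h, h', h''⟩
        · exact h
        · exact absurd ⟨a, c, c', d, hab.trans hbc, h, h', h''⟩ h₂
      obtain ⟨d, hbd, hd⟩ := hd
      obtain ⟨e, hce, he⟩ := he
      have i₁ := @inj b c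
      have i₂ := @inj e b
      have t := @dec₁ b c e hce
      have f₁ := fun h => h₁ ⟨a, b, c, e, hab, hbc, hce, h⟩
      have f₂ := fun h => h₂ ⟨a, b, c, e, hab, hbc, hce, h⟩
      clear inc dec₁ inv inj h₁ h₂ h₃
      grind
    · rintro ⟨a, b, c, d, hab, hbc, hcd, hs⟩
      have he : ∃ e, d < e ∧ (e ∈ l ∧ d ∈ l ∧ a ∈ l) ∧ (r e < r d ∧ r e < r a) ∧ r d < r a := by
        rcases inv (by omega : a < d) (by tauto) with h | ⟨c', d', h, h', h''⟩
        · exact h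
        · exact absurd ⟨a, d, c', d', by omega, h, h', h''⟩ h₂
      obtain ⟨e, hde, he⟩ := he
      have hba : r b < r a := by
        rcases inv hab (by tauto) with ⟨_, _, h⟩ | ⟨_, _, _, _, h⟩ <;> omega
      have hdb : r d < r b := by
        rcases inv (by omega : b < d) (by tauto) with ⟨_, _, h⟩ | ⟨_, _, _, _, h⟩ <;> omega
      have hdc : r d < r c := by
        rcases inv hcd (by tauto) with ⟨_, _, h⟩ | ⟨_, _, _, _, h⟩ <;> omega
      have t := @dec₁ a c d hcd
      have i := @inj a c
      have f := fun h => h₃ ⟨a, b, c, d, e, hab, hbc, hcd, hde, h⟩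
      clear inc dec₁ inv inj h₁ h₂ h₃
      grind

/-! ### The pop stack with bypass -/

theorem mem_psbAux {xs s : List ℕ} {y : ℕ} : y ∈ psbAux xs s ↔ y ∈ xs ∨ y ∈ s := by
  induction xs generalizing s with
  | nil => simp [psbAux]
  | cons x xs ih =>
    cases s with
    | nil => simp [psbAux, ih]; tauto
    | cons t s =>
      simp only [psbAux]
      split_ifs <;> simp [ih] <;> tauto

theorem Has231.mono {l l' : List ℕ} (h : Has231 l) (hs : l.Sublist l') : Has231 l' := by
  obtain ⟨a, b, c, h₁, h₂, h⟩ := h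
  exact ⟨a, b, c, h₁, h₂, h.trans hs⟩

theorem Has4213.mono {l l' : List ℕ} (h : Has4213 l) (hs : l.Sublist l') : Has4213 l' := by
  obtain ⟨a, b, c, d, h₁, h₂, h₃, h⟩ := h
  exact ⟨a, b, c, d, h₁, h₂, h₃, h.trans hs⟩

theorem mem_or_sublist_of_middle {τ l₁ l₂ : List ℕ} {m : ℕ} (h : τ.Sublist (l₁ ++ m :: l₂)) :
    m ∈ τ ∨ τ.Sublist (l₁ ++ l₂) := by
  obtain ⟨τ₁, τ₂, rfl, h₁, h₂⟩ := List.sublist_append_iff.1 h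
  rcases List.sublist_cons_iff.1 h₂ with h₂ | ⟨r, rfl, h₂⟩
  · exact Or.inr (h₁.append h₂)
  · simp

theorem pair_sublist_left {x y : ℕ} {l₁ l₂ : List ℕ} (hn : (l₁ ++ l₂).Nodup)
    (hs : [x, y].Sublist (l₁ ++ l₂)) (hy : y ∈ l₁) : [x, y].Sublist l₁ := by
  have hd := (List.nodup_append.1 hn).2.2 y hy
  rcases pair_sublist_append_iff.1 hs with h | ⟨_, h⟩ | h
  · exact h
  · exact absurd rfl (hd y h)
  · exact absurd rfl (hd y (h.subset (by simp)))

theorem cons_sublist_right {x : ℕ} {τ l₁ l₂ : List ℕ} (hs : (x :: τ).Sublist (l₁ ++ l₂))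
    (hx : x ∉ l₁) : (x :: τ).Sublist l₂ := by
  induction l₁ with
  | nil => exact hs
  | cons z l ih =>
    simp only [List.mem_cons, not_or] at hx
    rcases List.cons_sublist_cons'.1 hs with hs | ⟨h, _⟩
    · exact ih hs hx.2
    · exact absurd h hx.1

theorem pair_sublist_or_swap {x y : ℕ} {l : List ℕ} (hx : x ∈ l) (hy : y ∈ l) (hxy : x ≠ y) :
    [x, y].Sublist l ∨ [y, x].Sublist l := by
  induction l with
  | nil => simp at hx
  | cons z l ih =>
    simp only [pair_sublist_cons_iff, List.mem_cons] at *
    grind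

/-- Bypassing the least remaining entry does not affect the forbidden patterns. -/
theorem avoids_bypass_iff {x : ℕ} {S xs : List ℕ} (hn : (S ++ x :: xs).Nodup)
    (hS : S.Pairwise (· > ·))
    (hc : ∀ y ∈ S, ∀ z ∈ S, ∀ w, y ≤ w → w ≤ z → w ∈ S)
    (hmin : ∀ y ∈ S ++ x :: xs, x ≤ y) :
    ¬ Has231 (S ++ x :: xs) ∧ ¬ Has4213 (S ++ x :: xs) ↔
      ¬ Has231 (S ++ xs) ∧ ¬ Has4213 (S ++ xs) := by
  have hsub : (S ++ xs).Sublist (S ++ x :: xs) :=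
    (List.Sublist.refl S).append (List.sublist_cons_self _ _)
  have hxS : x ∉ S := fun h => (List.nodup_append.1 hn).2.2 x h x (by simp) rfl
  have hxxs : x ∉ xs := (List.nodup_cons.1 (List.nodup_append.1 hn).2.1).1
  have hmemS : ∀ {y}, [y, x].Sublist (S ++ x :: xs) → y ∈ S := by
    intro y h
    rcases pair_sublist_append_iff.1 h with h | h | h
    · exact h.subset (by simp)
    · exact h.1
    · rcases pair_sublist_cons_iff.1 h with h | h
      · exact absurd h.2 hxxs
      · exact absurd (h.subset (by simp)) hxxs
  refine ⟨fun h => ⟨fun h' => h.1 (h'.mono hsub), fun h' => h.2 (h'.mono hsub)⟩,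
    fun h => ⟨?_, ?_⟩⟩
  · rintro ⟨a, b, c, hab, hbc, hs⟩
    rcases mem_or_sublist_of_middle hs with hx | hs'
    · have hxa : x ≤ a := hmin a (hs.subset (by simp))
      have e : x = a := by
        simp only [List.mem_cons, List.not_mem_nil, or_false] at hx
        omega
      subst e
      have hcS : c ∈ S := hmemS (List.Sublist.trans (by simp) hs)
      have hbcs : [b, c].Sublist (S ++ x :: xs) := List.Sublist.trans (by simp) hs
      exact absurd (rel_of_pair_sublist hS (pair_sublist_left hn hbcs hcS)) (lt_asymm hbc)
    · exact h.1 ⟨a, b, c, hab, hbc, hs'⟩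
  · rintro ⟨a, b, c, d, hab, hbc, hcd, hs⟩
    rcases mem_or_sublist_of_middle hs with hx | hs'
    · have hxa : x ≤ a := hmin a (hs.subset (by simp))
      have e : x = a := by
        simp only [List.mem_cons, List.not_mem_nil, or_false] at hx
        omega
      subst e
      have hbS : b ∈ S := hmemS (List.Sublist.trans (by simp) hs)
      have hdS : d ∈ S := hmemS (List.Sublist.trans (by simp) hs)
      have hcS : c ∈ S := hc b hbS d hdS c hbc.le hcd.le
      have hxc : [x, c].Sublist (S ++ x :: xs) := List.Sublist.trans (by simp) hs
      exact hxS ((pair_sublist_left hn hxc hcS).subset (by simp))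
    · exact h.2 ⟨a, b, c, d, hab, hbc, hcd, hs'⟩

/-- Popping a decreasing initial run of least entries does not affect the forbidden patterns. -/
theorem avoids_pop_iff {S xs : List ℕ} (hn : (S ++ xs).Nodup) (hS : S.Pairwise (· > ·))
    (hlt : ∀ y ∈ S, ∀ z ∈ xs, y < z) :
    ¬ Has231 (S ++ xs) ∧ ¬ Has4213 (S ++ xs) ↔ ¬ Has231 xs ∧ ¬ Has4213 xs := by
  have hsub : xs.Sublist (S ++ xs) := List.sublist_append_right _ _
  have down : ∀ {y z}, y ∈ S → z < y → z ∈ S ++ xs → z ∈ S := by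
    intro y z hy hzy hz
    rcases List.mem_append.1 hz with hz | hz
    · exact hz
    · exact absurd (hlt y hy z hz) (lt_asymm hzy)
  refine ⟨fun h => ⟨fun h' => h.1 (h'.mono hsub), fun h' => h.2 (h'.mono hsub)⟩,
    fun h => ⟨?_, ?_⟩⟩
  · rintro ⟨a, b, c, hab, hbc, hs⟩
    by_cases hb : b ∈ S
    · have haS : a ∈ S := down hb hab (hs.subset (by simp))
      have hca : [c, a].Sublist (S ++ xs) := List.Sublist.trans (by simp) hs
      have hcS : c ∈ S := (pair_sublist_left hn hca haS).subset (by simp)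
      have hbcs : [b, c].Sublist (S ++ xs) := List.Sublist.trans (by simp) hs
      exact lt_asymm hbc (rel_of_pair_sublist hS (pair_sublist_left hn hbcs hcS))
    · exact h.1 ⟨a, b, c, hab, hbc, cons_sublist_right hs hb⟩
  · rintro ⟨a, b, c, d, hab, hbc, hcd, hs⟩
    by_cases hd : d ∈ S
    · have hcS : c ∈ S := down hd hcd (hs.subset (by simp))
      have hac : [a, c].Sublist (S ++ xs) := List.Sublist.trans (by simp) hs
      exact lt_asymm (hab.trans hbc) (rel_of_pair_sublist hS (pair_sublist_left hn hac hcS))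
    · exact h.2 ⟨a, b, c, d, hab, hbc, hcd, cons_sublist_right hs hd⟩

theorem avoids_of_decreasing {S : List ℕ} (hS : S.Pairwise (· > ·)) :
    ¬ Has231 S ∧ ¬ Has4213 S := by
  constructor
  · rintro ⟨a, b, c, hab, hbc, hs⟩
    have := hS.sublist hs
    simp at this
    omega
  · rintro ⟨a, b, c, d, hab, hbc, hcd, hs⟩
    have := hS.sublist hs
    simp at this
    omega

theorem psbAux_sorted_iff (xs s : List ℕ) (hn : (s.reverse ++ xs).Nodup)
    (hs : s.Pairwise (· < ·))
    (hc : ∀ y ∈ s, ∀ z ∈ s, ∀ w, y ≤ w → w ≤ z → w ∈ s)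
    (hC : ∀ y ∈ s.reverse ++ xs, ∀ z ∈ s.reverse ++ xs, ∀ w, y ≤ w → w ≤ z →
      w ∈ s.reverse ++ xs) :
    (psbAux xs s).Pairwise (· < ·) ↔
      ¬ Has231 (s.reverse ++ xs) ∧ ¬ Has4213 (s.reverse ++ xs) := by
  induction xs generalizing s with
  | nil =>
    have hrev : s.reverse.Pairwise (· > ·) := List.pairwise_reverse.2 hs
    simpa [psbAux, hs] using avoids_of_decreasing hrev
  | cons x xs ih =>
    cases s with
    | nil =>
      have := ih [x] (by simpa using hn) (by simp) (by simp; omega) (by simpa using hC)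
      simpa [psbAux] using this
    | cons t s =>
      have hrev : (t :: s).reverse.Pairwise (· > ·) := List.pairwise_reverse.2 hs
      have htmin : ∀ y ∈ t :: s, t ≤ y := by
        intro y hy
        rcases List.mem_cons.1 hy with rfl | hy
        · exact le_rfl
        · exact ((List.pairwise_cons.1 hs).1 y hy).le
      have hxs : x ∉ t :: s := fun h =>
        (List.nodup_append.1 hn).2.2 x (List.mem_reverse.2 h) x (by simp) rfl
      have hxxs : x ∉ xs := (List.nodup_cons.1 (List.nodup_append.1 hn).2.1).1
      simp only [psbAux]
      split_ifs with h₁ h₂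
      · have e : (t :: s).reverse ++ x :: xs = (x :: t :: s).reverse ++ xs := by simp
        rw [e] at hn hC ⊢
        refine ih _ hn (List.pairwise_cons.2 ⟨fun y hy => by have := htmin y hy; omega, hs⟩) ?_ hC
        intro y hy z hz w hyw hwz
        by_cases hwx : w = x
        · simp [hwx]
        · refine List.mem_cons_of_mem _ ?_
          have hlow : x ≤ y := by
            rcases List.mem_cons.1 hy with rfl | hy
            · exact le_rfl
            · have := htmin y hy; omega
          have hz' : z ∈ t :: s := by
            rcases List.mem_cons.1 hz with rfl | hz
            · omega
            · exact hz
          exact hc t (by simp) z hz' w (by omega) hwz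
      · by_cases hmin : ∀ y ∈ xs, x < y
        · have hmin' : ∀ y ∈ (t :: s).reverse ++ xs, x < y := by
            intro y hy
            rcases List.mem_append.1 hy with hy | hy
            · have := htmin y (List.mem_reverse.1 hy)
              omega
            · exact hmin y hy
          have hsub : ((t :: s).reverse ++ xs).Sublist ((t :: s).reverse ++ x :: xs) :=
            (List.Sublist.refl _).append (List.sublist_cons_self _ _)
          rw [avoids_bypass_iff hn hrev (by simpa only [List.mem_reverse] using hc)
            (by
              intro y hy
              rcases List.perm_middle.mem_iff.1 hy |> List.mem_cons.1 with rfl | hy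
              · exact le_rfl
              · exact (hmin' y hy).le), List.pairwise_cons,
            ih (t :: s) (hn.sublist hsub) hs hc ?_]
          · refine and_iff_right ?_
            intro y hy
            rw [mem_psbAux] at hy
            apply hmin'
            simpa only [List.mem_append, List.mem_reverse] using hy.symm
          · intro y hy z hz w hyw hwz
            have := hC y (hsub.subset hy) z (hsub.subset hz) w hyw hwz
            rcases List.perm_middle.mem_iff.1 this |> List.mem_cons.1 with rfl | h
            · exact absurd (hmin' y hy) (by omega)
            · exact h
        · push Not at hmin
          obtain ⟨m, hm, hmx⟩ := hmin
          have hmx' : m < x := lt_of_le_of_ne hmx (fun e => hxxs (e ▸ hm))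
          refine iff_of_false ?_ ?_
          · intro h
            exact absurd ((List.pairwise_cons.1 h).1 m (mem_psbAux.2 (Or.inl hm))) (by omega)
          · rintro ⟨ha, hb⟩
            have hp : t - 1 ∈ xs := by
              have := hC m (by simp [hm]) t (by simp) (t - 1) (by omega) (by omega)
              rcases List.mem_append.1 this with h | h
              · have := htmin _ (List.mem_reverse.1 h)
                omega
              · rcases List.mem_cons.1 h with h | h
                · omega
                · exact h
            rcases pair_sublist_or_swap hm hp (by omega) with h | h
            · refine hb ⟨m, x, t - 1, t, hmx', by omega, by omega, ?_⟩
              have e : [t].Sublist (t :: s).reverse := List.singleton_sublist.2 (by simp)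
              exact e.append (h.cons_cons x)
            · refine ha ⟨m, x, t - 1, hmx', by omega, ?_⟩
              exact (h.cons_cons x).trans (List.sublist_append_right _ _)
      · have htx : t < x := by
          have : x ≠ t := fun e => hxs (by simp [e])
          omega
        have hsx : ∀ y ∈ t :: s, y < x := by
          intro y hy
          by_contra hyx
          exact hxs (hc t (by simp) y hy x htx.le (by omega))
        by_cases hlt : ∀ y ∈ t :: s, ∀ z ∈ xs, y < z
        · have hlt' : ∀ y ∈ t :: s, ∀ z ∈ x :: xs, y < z := by
            intro y hy z hz
            rcases List.mem_cons.1 hz with rfl | hz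
            · exact hsx y hy
            · exact hlt y hy z hz
          rw [avoids_pop_iff hn hrev (by simpa only [List.mem_reverse] using hlt'),
            List.pairwise_append]
          have key := ih [x] (by simpa using (List.nodup_append.1 hn).2.1) (by simp)
            (by simp; omega) ?_
          · rw [key]
            simp only [List.reverse_singleton, List.singleton_append]
            constructor
            · exact fun h => h.2.1
            · refine fun h => ⟨hs, h, ?_⟩
              intro y hy z hz
              refine hlt' y hy z ?_
              rw [mem_psbAux] at hz
              simpa [or_comm] using hz
          · simp only [List.reverse_singleton, List.singleton_append]
            intro y hy z hz w hyw hwz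
            have := hC y (by simp only [List.mem_append, hy, or_true])
              z (by simp only [List.mem_append, hz, or_true]) w hyw hwz
            rcases List.mem_append.1 this with h | h
            · exact absurd (hlt' w (List.mem_reverse.1 h) y hy) (by omega)
            · exact h
        · push Not at hlt
          obtain ⟨y, hy, z, hz, hzy⟩ := hlt
          have hne : z ≠ y := by
            rintro rfl
            exact (List.nodup_append.1 hn).2.2 z (List.mem_reverse.2 hy) z (by simp [hz]) rfl
          refine iff_of_false ?_ ?_
          · intro h
            have := (List.pairwise_append.1 h).2.2 y hy z (mem_psbAux.2 (Or.inl hz))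
            omega
          · rintro ⟨ha, -⟩
            refine ha ⟨z, y, x, by omega, hsx y hy, ?_⟩
            have e : [y].Sublist (t :: s).reverse :=
              List.singleton_sublist.2 (List.mem_reverse.2 hy)
            exact e.append (List.Sublist.cons_cons x (List.singleton_sublist.2 hz))

theorem psbAux_perm (xs s : List ℕ) : (psbAux xs s).Perm (xs ++ s) := by
  induction xs generalizing s with
  | nil => simp [psbAux]
  | cons x xs ih =>
    cases s with
    | nil => simpa [psbAux] using (ih [x]).trans List.perm_append_comm
    | cons t s =>
      simp only [psbAux]
      split_ifs
      · exact (ih _).trans List.perm_middle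
      · exact (ih _).cons x
      · refine ((ih [x]).append_left (t :: s)).trans (List.perm_append_comm.trans ?_)
        exact List.Perm.append_right _ (List.perm_append_comm (l₂ := [x]))

theorem psb_eq_range'_iff {n : ℕ} {l : List ℕ} (hl : l.Perm (List.range' 1 n)) :
    psb l = List.range' 1 n ↔ ¬ Has231 l ∧ ¬ Has4213 l := by
  have hmem : ∀ y, y ∈ l ↔ 1 ≤ y ∧ y < 1 + n := by
    intro y
    rw [hl.mem_iff, List.mem_range'_1]
  have key := psbAux_sorted_iff l [] (by simpa using hl.nodup_iff.2 List.nodup_range')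
    (by simp) (by simp) (by simp only [List.reverse_nil, List.nil_append, hmem]; omega)
  simp only [List.reverse_nil, List.nil_append] at key
  rw [← key]
  have hr : (List.range' 1 n).Pairwise (· < ·) := List.pairwise_lt_range'
  constructor
  · intro h
    rw [← h] at hr
    exact hr
  · intro h
    have hp : (psbAux l []).Perm (List.range' 1 n) := (psbAux_perm l []).trans (by simpa using hl)
    exact hp.eq_of_pairwise (fun a b _ _ h₁ h₂ => absurd h₁ (lt_asymm h₂)) h hr

theorem psb_queuesort_sorts_iff (n : ℕ) (π : List ℕ) (hπ : IsPermList n π) :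
    psb (queuesort π) = List.range' 1 n ↔
      Avoids π [4, 2, 3, 1] ∧ Avoids π [2, 4, 3, 1] ∧ Avoids π [5, 4, 2, 1, 3] := by
  have hl : π.Nodup := hπ.nodup_iff.2 List.nodup_range'
  have hperm : (queuesort π).Perm π := by simpa using (queueRun_queuesort hl).perm
  rw [psb_eq_range'_iff (hperm.trans hπ), queuesort_avoids_iff hl]
end
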